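/- arXiv:1601.05917 — 3 statements merged into one kernel-verified Lean document; each statement's English description precedes it below -/
import Mathlib

section
/- Let X be a {0,1}-valued random variable and Y a random variable with values in a finite set, jointly distributed according to a pmf p. Then Z(X|Y)^2 ≤ H(X|Y). -/
open scoped BigOperators

noncomputable section

/-- A probability mass function on a finite type. -/
def IsPMF {α : Type*} [Fintype α] (p : α → ℝ) : Prop :=
  (∀ a, 0 ≤ p a) ∧ ∑ a, p a = 1

/-- Shannon entropy (base 2), with the convention `0 * log₂ 0 = 0`. -/
def ent {α : Type*} [Fintype α] (p : α → ℝ) : ℝ :=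
  -∑ a, p a * Real.logb 2 (p a)

/-- Marginal of a joint pmf on the second component. -/
def margSnd {α β : Type*} [Fintype α] [Fintype β] (p : α × β → ℝ) : β → ℝ :=
  fun b => ∑ a, p (a, b)

/-- Marginal of a joint pmf on the first component. -/
def margFst {α β : Type*} [Fintype α] [Fintype β] (p : α × β → ℝ) : α → ℝ :=
  fun a => ∑ b, p (a, b)

/-- Conditional entropy H(X|Y) of a joint pmf on α × β
(terms with `p (a, b) = 0` vanish since `0 * log₂ _ = 0`). -/
def condEnt {α β : Type*} [Fintype α] [Fintype β] (p : α × β → ℝ) : ℝ :=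
  -∑ a, ∑ b, p (a, b) * Real.logb 2 (p (a, b) / margSnd p b)

/-- Mutual information I(X;Y) = H(X) - H(X|Y) of a joint pmf on α × β. -/
def mutInfo {α β : Type*} [Fintype α] [Fintype β] (p : α × β → ℝ) : ℝ :=
  ent (margFst p) - condEnt p

/-- Pushforward of a pmf along a map. -/
def pushPMF {α β : Type*} [Fintype α] [DecidableEq β] (p : α → ℝ) (f : α → β) : β → ℝ :=
  fun b => ∑ a, if f a = b then p a else 0

/-- Entropy H(A) of a random variable A on the finite probability space (Ω, p). -/
def entOf {Ω α : Type*} [Fintype Ω] [Fintype α] [DecidableEq α] (p : Ω → ℝ) (A : Ω → α) : ℝ :=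
  ent (pushPMF p A)

/-- Conditional entropy H(A|B) of random variables on (Ω, p). -/
def condEntOf {Ω α β : Type*} [Fintype Ω] [Fintype α] [Fintype β] [DecidableEq α] [DecidableEq β]
    (p : Ω → ℝ) (A : Ω → α) (B : Ω → β) : ℝ :=
  condEnt (pushPMF p (fun ω => (A ω, B ω)))

/-- Mutual information I(A;B) of random variables on (Ω, p). -/
def mutInfoOf {Ω α β : Type*} [Fintype Ω] [Fintype α] [Fintype β] [DecidableEq α] [DecidableEq β]
    (p : Ω → ℝ) (A : Ω → α) (B : Ω → β) : ℝ :=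
  entOf p A - condEntOf p A B

/-- Conditional mutual information I(A;B|C) = H(A|C) - H(A|(B,C)). -/
def condMutInfoOf {Ω α β γ : Type*} [Fintype Ω] [Fintype α] [Fintype β] [Fintype γ]
    [DecidableEq α] [DecidableEq β] [DecidableEq γ]
    (p : Ω → ℝ) (A : Ω → α) (B : Ω → β) (C : Ω → γ) : ℝ :=
  condEntOf p A C - condEntOf p A (fun ω => (B ω, C ω))

/-- Bhattacharyya parameter Z(X|Y) = 2 ∑_y √(p(0,y) p(1,y)) for binary X. -/
def bhat {β : Type*} [Fintype β] (p : ZMod 2 × β → ℝ) : ℝ :=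
  2 * ∑ b, Real.sqrt (p (0, b) * p (1, b))

lemma four_mul_log_two_le_binEntropy {x : ℝ} (hx₀ : 0 < x) (hx₁ : x < 1) :
    4 * (x * (1 - x)) * Real.log 2 ≤ Real.binEntropy x := by
  have hy : 0 < 1 - x := by linarith
  let G : ℝ → ℝ := fun t => x * Real.log (x + t * (1 - x)) + (1 - x) * Real.log (1 - x + t * x)
    - 4 * (x * (1 - x)) * Real.log (1 + t)
  have hG : ∀ t : ℝ, 0 ≤ t → HasDerivAt G
      (x * ((1 - x) / (x + t * (1 - x))) + (1 - x) * (x / (1 - x + t * x))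
        - 4 * (x * (1 - x)) * (1 / (1 + t))) t := by
    intro t ht
    have h₁ : HasDerivAt (fun t : ℝ => x + t * (1 - x)) (1 - x) t := by
      simpa using ((hasDerivAt_id t).mul_const (1 - x)).const_add x
    have h₂ : HasDerivAt (fun t : ℝ => 1 - x + t * x) x t := by
      simpa using ((hasDerivAt_id t).mul_const x).const_add (1 - x)
    have h₃ : HasDerivAt (fun t : ℝ => 1 + t) 1 t := (hasDerivAt_id t).const_add 1
    exact (((h₁.log (by positivity)).const_mul x).add
      ((h₂.log (by positivity)).const_mul (1 - x))).sub
      ((h₃.log (by positivity)).const_mul (4 * (x * (1 - x))))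
  have hmono : MonotoneOn G (Set.Icc 0 1) := by
    refine monotoneOn_of_deriv_nonneg (convex_Icc 0 1)
      (fun t ht => (hG t ht.1).continuousAt.continuousWithinAt)
      (fun t ht => (hG t (interior_subset ht).1).differentiableAt.differentiableWithinAt) ?_
    intro t ht
    have ht₀ : 0 ≤ t := (interior_subset ht).1
    rw [(hG t ht₀).deriv]
    have hu : 0 < x + t * (1 - x) := by positivity
    have hv : 0 < 1 - x + t * x := by positivity
    have hw : 0 < 1 + t := by positivity
    have key : x * ((1 - x) / (x + t * (1 - x))) + (1 - x) * (x / (1 - x + t * x))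
        - 4 * (x * (1 - x)) * (1 / (1 + t)) =
        x * (1 - x) * ((x + t * (1 - x)) - (1 - x + t * x)) ^ 2 /
          ((x + t * (1 - x)) * (1 - x + t * x) * (1 + t)) := by
      field_simp
      ring
    rw [key]
    positivity
  have h := hmono (Set.left_mem_Icc.2 zero_le_one) (Set.right_mem_Icc.2 zero_le_one) zero_le_one
  norm_num [G] at h
  rw [Real.binEntropy, Real.log_inv, Real.log_inv]
  linarith

lemma four_mul_le_add_mul_entropy {a b : ℝ} (ha : 0 ≤ a) (hb : 0 ≤ b) :
    4 * (a * b) ≤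
      (a + b) * -(a * Real.logb 2 (a / (a + b)) + b * Real.logb 2 (b / (a + b))) := by
  rcases ha.eq_or_lt with rfl | ha
  · rcases hb.eq_or_lt with rfl | hb
    · simp
    · simp [hb.ne']
  rcases hb.eq_or_lt with rfl | hb
  · simp [ha.ne']
  have hs : 0 < a + b := by positivity
  have hx₁ : a / (a + b) < 1 := by rw [div_lt_one hs]; linarith
  have hsub : 1 - a / (a + b) = b / (a + b) := by field_simp; ring
  have h := four_mul_log_two_le_binEntropy (div_pos ha hs) hx₁
  rw [Real.binEntropy, hsub, Real.log_inv, Real.log_inv,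
    ← le_div_iff₀ (Real.log_pos one_lt_two)] at h
  have hsq := mul_le_mul_of_nonneg_left h (sq_nonneg (a + b))
  calc 4 * (a * b) = (a + b) ^ 2 * (4 * (a / (a + b) * (b / (a + b)))) := by field_simp
    _ ≤ _ := hsq
    _ = _ := by
      simp only [Real.logb]
      field_simp
      ring

/-- For a joint pmf `p` of a binary `X` and finite-valued `Y`,
`Z(X|Y)² ≤ H(X|Y)`. -/
theorem bhat_sq_le_condEnt {β : Type*} [Fintype β]
    (p : ZMod 2 × β → ℝ) (hp : IsPMF p) :
    bhat p ^ 2 ≤ condEnt p := by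
  obtain ⟨hp₀, hp₁⟩ := hp
  have hmarg : ∀ b, margSnd p b = p (0, b) + p (1, b) := fun b => Fin.sum_univ_two _
  have hsum : ∑ b, (p (0, b) + p (1, b)) = 1 := by
    rw [← hp₁, Fintype.sum_prod_type_right]
    exact Finset.sum_congr rfl fun b _ => (hmarg b).symm
  have hent : condEnt p = ∑ b, -(p (0, b) * Real.logb 2 (p (0, b) / (p (0, b) + p (1, b)))
      + p (1, b) * Real.logb 2 (p (1, b) / (p (0, b) + p (1, b)))) := by
    rw [condEnt, Finset.sum_comm, Finset.sum_neg_distrib]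
    congr 1
    refine Finset.sum_congr rfl fun b _ => ?_
    rw [hmarg]
    exact Fin.sum_univ_two _
  have hpoint := fun b => four_mul_le_add_mul_entropy (hp₀ (0, b)) (hp₀ (1, b))
  rw [bhat, Finset.mul_sum, hent, ← one_mul (∑ b, -_), ← hsum]
  refine Finset.sum_sq_le_sum_mul_sum_of_sq_le_mul _ (fun b _ => add_nonneg (hp₀ _) (hp₀ _))
    (fun b _ => ?_) (fun b _ => ?_)
  · have hterm : ∀ {u v : ℝ}, 0 ≤ u → 0 ≤ v → u * Real.logb 2 (u / (u + v)) ≤ 0 :=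
      fun hu hv => mul_nonpos_of_nonneg_of_nonpos hu <| Real.logb_nonpos one_lt_two
        (by positivity) (div_le_one_of_le₀ (by linarith) (by positivity))
    have h₁ := hterm (hp₀ (1, b)) (hp₀ (0, b))
    rw [add_comm (p (1, b))] at h₁
    linarith [hterm (hp₀ (0, b)) (hp₀ (1, b))]
  · rw [mul_pow, Real.sq_sqrt (mul_nonneg (hp₀ _) (hp₀ _))]
    linarith [hpoint b]
end
end

section
/- Let X be a {0,1}-valued random variable and Y a random variable with values in a finite set, jointly distributed according to a pmf p. Then H(X|Y) ≤ log₂(1 + Z(X|Y)). -/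
open scoped BigOperators

noncomputable section

lemma neg_log_sq_div_le {u s m T : ℝ} (hu : 0 < u) (hs : 0 < s) (hm : 0 < m) (hT : 0 < T) :
    -Real.log (u ^ 2 / m) ≤ Real.log T + s ^ 2 / (m * T) - 1 + 2 * (m / (u * s) - 1) := by
  have h₁ := Real.log_le_sub_one_of_pos (show 0 < m / (u * s) by positivity)
  have h₂ := Real.log_le_sub_one_of_pos (show 0 < s ^ 2 / (m * T) by positivity)
  rw [Real.log_div (by positivity) (by positivity), Real.log_mul (by positivity) (by positivity)]
    at h₁ h₂
  rw [Real.log_pow] at h₂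
  rw [Real.log_div (by positivity) (by positivity), Real.log_pow]
  push_cast at *
  linarith

/-- Tangent-line bound for the two-point conditional entropy: averaging it over `Y` with
`T = 1 + Z(X|Y)` gives the bound on the conditional entropy. -/
lemma two_point_entropy_le {x y T : ℝ} (hx : 0 ≤ x) (hy : 0 ≤ y) (hT : 0 < T) :
    -(x * Real.log (x / (x + y)) + y * Real.log (y / (x + y))) ≤
      (x + y) * Real.log T + (x + y + 2 * √(x * y)) / T - (x + y) := by
  rcases (add_nonneg hx hy).eq_or_lt with h0 | hm
  · obtain rfl : x = 0 := by linarith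
    obtain rfl : y = 0 := by linarith
    simp
  set s := √x + √y with hs_def
  have hsq : s ^ 2 = x + y + 2 * √(x * y) := by
    rw [Real.sqrt_mul hx, hs_def, add_sq, Real.sq_sqrt hx, Real.sq_sqrt hy]
    ring
  have hs : 0 < s := by
    refine lt_of_le_of_ne (by positivity) fun h => ?_
    rw [← h] at hsq
    nlinarith [Real.sqrt_nonneg (x * y)]
  have bound : ∀ z : ℝ, 0 ≤ z → -(z * Real.log (z / (x + y))) ≤
      z * (Real.log T + s ^ 2 / ((x + y) * T) - 1) + 2 * (√z * (x + y) / s - z) := by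
    intro z hz
    rcases hz.eq_or_lt with rfl | hz'
    · simp
    have hu := Real.sqrt_pos.2 hz'
    have h := mul_le_mul_of_nonneg_left (neg_log_sq_div_le hu hs hm hT) hz
    have hdiv : z * ((x + y) / (√z * s)) = √z * (x + y) / s := by
      field_simp
      rw [Real.sq_sqrt hz]
    rw [Real.sq_sqrt hz] at h
    linarith
  have hsum : √x * (x + y) / s + √y * (x + y) / s = x + y := by
    rw [← add_div, ← add_mul, ← hs_def]
    field_simp
  have hT' : (x + y) * (s ^ 2 / ((x + y) * T)) = s ^ 2 / T := by
    field_simp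
  rw [← hsq]
  linarith [bound x hx, bound y hy]

/-- For a joint pmf `p` of a binary `X` and finite-valued `Y`,
`H(X|Y) ≤ log₂(1 + Z(X|Y))`. -/
theorem condEnt_le_logb_one_add_bhat {β : Type*} [Fintype β]
    (p : ZMod 2 × β → ℝ) (hp : IsPMF p) :
    condEnt p ≤ Real.logb 2 (1 + bhat p) := by
  obtain ⟨hnn, hsum⟩ := hp
  have hsplit (f : ZMod 2 → ℝ) : ∑ a, f a = f 0 + f 1 := Fin.sum_univ_two f
  have hZ : 0 ≤ bhat p := by unfold bhat; positivity
  have hT : 0 < 1 + bhat p := by linarith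
  rw [Fintype.sum_prod_type, hsplit, ← Finset.sum_add_distrib] at hsum
  have key := Finset.sum_le_sum fun b (_ : b ∈ Finset.univ) =>
    two_point_entropy_le (hnn (0, b)) (hnn (1, b)) hT
  have hbhat : ∑ b, (p (0, b) + p (1, b) + 2 * √(p (0, b) * p (1, b))) = 1 + bhat p := by
    rw [Finset.sum_add_distrib, hsum, bhat, Finset.mul_sum]
  rw [Finset.sum_sub_distrib, Finset.sum_add_distrib, ← Finset.sum_mul, ← Finset.sum_div, hbhat,
    hsum, div_self hT.ne'] at key
  have hent : condEnt p = (∑ b, -(p (0, b) * Real.log (p (0, b) / (p (0, b) + p (1, b))) +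
      p (1, b) * Real.log (p (1, b) / (p (0, b) + p (1, b))))) / Real.log 2 := by
    simp only [condEnt, margSnd, hsplit, Real.logb, Finset.sum_neg_distrib,
      Finset.sum_add_distrib, neg_div, add_div, Finset.sum_div, mul_div_assoc]
  rw [hent, Real.logb]
  have hlog := Real.log_pos one_lt_two
  gcongr
  linarith
end
end

section
/- Fix β ∈ (0,1/2) and a pair of random variables (X,Y) with X ∈ {0,1} = F₂ and Y in a finite set. For k ∈ ℕ and n = 2^k, with U^{1:n} = X^{1:n}G_n as defined in the context, the following limits hold as k → ∞: (1/n)·|{i ∈ {1,…,n} : Z(U^i | Y^{1:n}, U^{1:i−1}) ≥ 1 − 2^{−n^β}}| → H(X|Y), and (1/n)·|{i ∈ {1,…,n} : Z(U^i | Y^{1:n}, U^{1:i−1}) ≤ 2^{−n^β}}| → 1 − H(X|Y). -/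
open scoped BigOperators

noncomputable section

/-- The polar matrix `G_n`, the k-fold Kronecker power of ((1,0),(1,1)) over F₂. -/
def polarG : ∀ k : ℕ, Matrix (Fin (2 ^ k)) (Fin (2 ^ k)) (ZMod 2)
  | 0 => 1
  | k + 1 =>
      Matrix.reindex (finProdFinEquiv.trans (finCongr (pow_succ 2 k).symm))
        (finProdFinEquiv.trans (finCongr (pow_succ 2 k).symm))
        (Matrix.kroneckerMap (· * ·) (polarG k)
          (!![1, 0; 1, 1] : Matrix (Fin 2) (Fin 2) (ZMod 2)))

/-- Joint pmf of `n` i.i.d. copies of a pair `(X, Y) ~ p`. -/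
def iidPair {β : Type*} [Fintype β] (p : ZMod 2 × β → ℝ) (n : ℕ) :
    (Fin n → ZMod 2) × (Fin n → β) → ℝ :=
  fun xy => ∏ i, p (xy.1 i, xy.2 i)

/-- The polarized sequence `U^{1:n} = X^{1:n} G_n`. -/
def polarU (k : ℕ) (x : Fin (2 ^ k) → ZMod 2) : Fin (2 ^ k) → ZMod 2 :=
  Matrix.vecMul x (polarG k)

/-- The Bhattacharyya parameter `Z(U^i | Y^{1:n}, U^{1:i-1})`. -/
def polarZ {β : Type*} [Fintype β] [DecidableEq β] (p : ZMod 2 × β → ℝ) (k : ℕ)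
    (i : Fin (2 ^ k)) : ℝ :=
  bhat (pushPMF (iidPair p (2 ^ k))
    (fun xy => (polarU k xy.1 i,
      (xy.2, fun j : Fin i.val => polarU k xy.1 (Fin.castLE i.isLt.le j)))))

/-- The Bhattacharyya parameter `Z(U^i | U^{1:i-1})`. -/
def polarZU {β : Type*} [Fintype β] (p : ZMod 2 × β → ℝ) (k : ℕ)
    (i : Fin (2 ^ k)) : ℝ :=
  bhat (pushPMF (iidPair p (2 ^ k))
    (fun xy => (polarU k xy.1 i,
      fun j : Fin i.val => polarU k xy.1 (Fin.castLE i.isLt.le j))))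

/-- The Bhattacharyya parameter `Z(U^i | (obs ∘ Y)^{1:n}, U^{1:i-1})`, where each
output symbol is observed through the map `obs`. -/
def polarZobs {β γ : Type*} [Fintype β] [Fintype γ] [DecidableEq γ] (p : ZMod 2 × β → ℝ)
    (obs : β → γ) (k : ℕ) (i : Fin (2 ^ k)) : ℝ :=
  bhat (pushPMF (iidPair p (2 ^ k))
    (fun xy => (polarU k xy.1 i,
      (fun j => obs (xy.2 j), fun j : Fin i.val => polarU k xy.1 (Fin.castLE i.isLt.le j)))))

/-- The average of `F` over the `2 ^ k` indices of level `k` of the binary tree. -/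
def levelAvg (k : ℕ) (F : ℕ → ℝ) : ℝ :=
  (∑ i ∈ Finset.range (2 ^ k), F i) / 2 ^ k

lemma sum_range_two_mul (N : ℕ) (F : ℕ → ℝ) :
    ∑ i ∈ Finset.range (2 * N), F i = ∑ i ∈ Finset.range N, (F (2 * i) + F (2 * i + 1)) := by
  induction N with
  | zero => simp
  | succ N ih =>
    rw [Finset.sum_range_succ _ N, ← ih, Nat.mul_succ, Finset.sum_range_succ,
      Finset.sum_range_succ, add_assoc]

lemma levelAvg_succ (k : ℕ) (F : ℕ → ℝ) :
    levelAvg (k + 1) F = levelAvg k (fun i => (F (2 * i) + F (2 * i + 1)) / 2) := by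
  unfold levelAvg
  rw [pow_succ', sum_range_two_mul, ← Finset.sum_div, pow_succ', div_div]

lemma levelAvg_mono {k : ℕ} {F G : ℕ → ℝ} (h : ∀ i < 2 ^ k, F i ≤ G i) :
    levelAvg k F ≤ levelAvg k G := by
  unfold levelAvg
  gcongr with i hi
  exact h i (Finset.mem_range.1 hi)

lemma levelAvg_congr {k : ℕ} {F G : ℕ → ℝ} (h : ∀ i < 2 ^ k, F i = G i) :
    levelAvg k F = levelAvg k G :=
  le_antisymm (levelAvg_mono fun i hi => (h i hi).le) (levelAvg_mono fun i hi => (h i hi).ge)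

lemma levelAvg_add (k : ℕ) (F G : ℕ → ℝ) :
    levelAvg k (fun i => F i + G i) = levelAvg k F + levelAvg k G := by
  simp only [levelAvg, Finset.sum_add_distrib, add_div]

lemma levelAvg_const_mul (k : ℕ) (c : ℝ) (F : ℕ → ℝ) :
    levelAvg k (fun i => c * F i) = c * levelAvg k F := by
  simp only [levelAvg, ← Finset.mul_sum, mul_div_assoc]

lemma levelAvg_const (k : ℕ) (c : ℝ) : levelAvg k (fun _ => c) = c := by
  simp [levelAvg]

open Classical in
/-- The proportion of the indices of level `k` satisfying `P`. -/
def levelFrac (k : ℕ) (P : ℕ → Prop) : ℝ :=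
  levelAvg k (fun i => if P i then 1 else 0)

lemma levelFrac_mono {k : ℕ} {P Q : ℕ → Prop} (h : ∀ i < 2 ^ k, P i → Q i) :
    levelFrac k P ≤ levelFrac k Q := by
  refine levelAvg_mono fun i hi => ?_
  have := h i hi
  split_ifs <;> simp_all

lemma levelFrac_add_le_one {k : ℕ} {P Q : ℕ → Prop} (h : ∀ i < 2 ^ k, P i → ¬ Q i) :
    levelFrac k P + levelFrac k Q ≤ 1 := by
  unfold levelFrac
  rw [← levelAvg_add]
  refine (levelAvg_mono (G := fun _ => 1) fun i hi => ?_).trans_eq (levelAvg_const k 1)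
  have := h i hi
  split_ifs <;> simp_all

lemma natCard_div_eq_levelFrac (k : ℕ) (P : Fin (2 ^ k) → Prop) (Q : ℕ → Prop)
    (h : ∀ i : Fin (2 ^ k), P i ↔ Q i) :
    (Nat.card {i : Fin (2 ^ k) // P i} : ℝ) / ((2 ^ k : ℕ) : ℝ) = levelFrac k Q := by
  classical
  unfold levelFrac levelAvg
  rw [Nat.card_eq_fintype_card, Fintype.card_subtype, Finset.sum_range]
  simp [h]

/-- The number of the last `n` steps on the path to `i` that branch in direction `s`. -/
def stepCount (s : ℕ) : ℕ → ℕ → ℕ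
  | 0, _ => 0
  | n + 1, i => stepCount s n (i / 2) + if i % 2 = s then 1 else 0

/-- The accumulated loss along the last `n` steps on the path to `i`. -/
def stepLoss (s : ℕ) : ℕ → ℕ → ℝ
  | 0, _ => 0
  | n + 1, i => stepLoss s n (i / 2) + (2 ^ stepCount s (n + 1) i)⁻¹

lemma two_mul_add_one_div_two (i : ℕ) : (2 * i + 1) / 2 = i := by omega

lemma two_mul_add_one_mod_two (i : ℕ) : (2 * i + 1) % 2 = 1 := by omega

lemma levelAvg_inv_two_pow_stepCount {s : ℕ} (hs : s = 0 ∨ s = 1) (m n : ℕ) :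
    levelAvg (m + n) (fun i => ((2 : ℝ) ^ stepCount s n i)⁻¹) = (3 / 4) ^ n := by
  induction n with
  | zero => simp [stepCount, levelAvg_const]
  | succ n ih =>
    rw [← add_assoc, levelAvg_succ, pow_succ', ← ih, ← levelAvg_const_mul]
    refine levelAvg_congr fun i _ => ?_
    rcases hs with rfl | rfl <;>
      simp [stepCount, two_mul_add_one_div_two, two_mul_add_one_mod_two, pow_succ] <;> ring

lemma levelAvg_stepLoss {s : ℕ} (hs : s = 0 ∨ s = 1) (m n : ℕ) :
    levelAvg (m + n) (stepLoss s n) = 3 * (1 - (3 / 4) ^ n) := by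
  induction n with
  | zero => simp [stepLoss, levelAvg]
  | succ n ih =>
    have h : levelAvg (m + (n + 1)) (stepLoss s (n + 1)) =
        levelAvg (m + n) (stepLoss s n) +
          levelAvg (m + (n + 1)) (fun i => ((2 : ℝ) ^ stepCount s (n + 1) i)⁻¹) := by
      rw [← add_assoc, levelAvg_succ, levelAvg_succ, ← levelAvg_add]
      refine levelAvg_congr fun i _ => ?_
      simp only [stepLoss, two_mul_add_one_div_two, Nat.mul_div_cancel_left i two_pos]
      ring
    rw [h, ih, levelAvg_inv_two_pow_stepCount hs]
    ring

lemma levelAvg_stepCount_sq {s : ℕ} (hs : s = 0 ∨ s = 1) (m n : ℕ) :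
    levelAvg (m + n) (fun i => (2 * (stepCount s n i : ℝ) - n) ^ 2) = n := by
  induction n with
  | zero => simp [stepCount, levelAvg_const]
  | succ n ih =>
    have h : levelAvg (m + (n + 1)) (fun i => (2 * (stepCount s (n + 1) i : ℝ) - (n + 1 : ℕ)) ^ 2) =
        levelAvg (m + n) (fun i => (2 * (stepCount s n i : ℝ) - n) ^ 2 + 1) := by
      rw [← add_assoc, levelAvg_succ]
      refine levelAvg_congr fun i _ => ?_
      rcases hs with rfl | rfl <;>
        simp [stepCount, two_mul_add_one_div_two, two_mul_add_one_mod_two] <;> ring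
    rw [h, levelAvg_add, ih, levelAvg_const, Nat.cast_succ]

lemma levelAvg_ancestor (m n : ℕ) (F : ℕ → ℝ) :
    levelAvg (m + n) (fun i => F (i / 2 ^ n)) = levelAvg m F := by
  induction n with
  | zero => simp
  | succ n ih =>
    rw [← add_assoc, levelAvg_succ, ← ih]
    refine levelAvg_congr fun i _ => ?_
    simp only [pow_succ', ← Nat.div_div_eq_div_mul, two_mul_add_one_div_two,
      Nat.mul_div_cancel_left i two_pos]
    ring

lemma stepLoss_nonneg (s n i : ℕ) : 0 ≤ stepLoss s n i := by
  induction n generalizing i with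
  | zero => simp [stepLoss]
  | succ n ih => exact add_nonneg (ih _) (by positivity)

/-- A process on the binary tree which is squared in direction `s` and at most doubled in the
other direction. -/
structure IsSquaringProcess (A : ℕ → ℕ → ℝ) (s : ℕ) : Prop where
  nonneg : ∀ k i, i < 2 ^ k → 0 ≤ A k i
  le_sq : ∀ k i, i < 2 ^ k → A (k + 1) (2 * i + s) ≤ A k i ^ 2
  le_two_mul : ∀ k i, i < 2 ^ k → A (k + 1) (2 * i + (1 - s)) ≤ 2 * A k i

lemma IsSquaringProcess.le_rpow {A : ℕ → ℕ → ℝ} {s : ℕ} (hA : IsSquaringProcess A s)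
    (hs : s = 0 ∨ s = 1) (m n i : ℕ) (hi : i < 2 ^ (m + n)) (M : ℝ)
    (h : A m (i / 2 ^ n) ≤ (2 : ℝ) ^ (-M)) :
    A (m + n) i ≤ (2 : ℝ) ^ (-((2 : ℝ) ^ stepCount s n i * (M - stepLoss s n i))) := by
  induction n generalizing i with
  | zero => simpa [stepCount, stepLoss] using h
  | succ n ih =>
    have hi2 : i / 2 < 2 ^ (m + n) := by
      rw [← add_assoc, pow_succ] at hi
      omega
    have hprev := ih (i / 2) hi2 (by rwa [Nat.div_div_eq_div_mul, ← pow_succ'])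
    have h0 := hA.nonneg (m + n) (i / 2) hi2
    by_cases his : i % 2 = s
    · have hstep := hA.le_sq (m + n) (i / 2) hi2
      rw [← his, Nat.div_add_mod] at hstep
      refine hstep.trans ((pow_le_pow_left₀ h0 hprev 2).trans ?_)
      rw [← Real.rpow_natCast, ← Real.rpow_mul two_pos.le]
      refine Real.rpow_le_rpow_of_exponent_le one_le_two ?_
      have hc : ((2 : ℝ) ^ stepCount s n (i / 2)) ≠ 0 := by positivity
      simp only [stepCount, stepLoss, his, if_true, pow_succ]
      field_simp
      norm_num
      linarith
    · have hstep := hA.le_two_mul (m + n) (i / 2) hi2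
      have hidx : 2 * (i / 2) + (1 - s) = i := by omega
      rw [hidx] at hstep
      refine hstep.trans ((mul_le_mul_of_nonneg_left hprev two_pos.le).trans ?_)
      nth_rewrite 1 [← Real.rpow_one 2]
      rw [← Real.rpow_add two_pos]
      refine Real.rpow_le_rpow_of_exponent_le one_le_two ?_
      have hc : ((2 : ℝ) ^ stepCount s n (i / 2)) ≠ 0 := by positivity
      simp only [stepCount, stepLoss, his, if_false, add_zero]
      field_simp
      linarith

lemma IsSquaringProcess.levelFrac_le {A : ℕ → ℕ → ℝ} {s : ℕ} (hA : IsSquaringProcess A s)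
    (hs : s = 0 ∨ s = 1) {b c M : ℝ} (hM : 1 < M) (hc : c < 1 / 2) (m n : ℕ) (hn : 0 < n)
    (hbc : b * ((m + n : ℕ) : ℝ) ≤ c * n) :
    levelFrac m (fun i => A m i ≤ (2 : ℝ) ^ (-M)) ≤
      levelFrac (m + n) (fun i => A (m + n) i ≤ (2 : ℝ) ^ (-(((2 ^ (m + n) : ℕ) : ℝ) ^ b))) +
        (M - 1)⁻¹ * 3 + ((1 - 2 * c) ^ 2 * n)⁻¹ := by
  have hn' : (0 : ℝ) < n := Nat.cast_pos.2 hn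
  have hc' : 0 < 1 - 2 * c := by linarith
  have hM' : 0 < M - 1 := by linarith
  have hloss : levelAvg (m + n) (stepLoss s n) ≤ 3 := by
    rw [levelAvg_stepLoss hs]
    have : (0 : ℝ) ≤ (3 / 4) ^ n := by positivity
    linarith
  have hsq : ((1 - 2 * c) ^ 2 * n)⁻¹ = ((1 - 2 * c) ^ 2 * (n : ℝ) ^ 2)⁻¹ *
      levelAvg (m + n) (fun i => (2 * (stepCount s n i : ℝ) - n) ^ 2) := by
    rw [levelAvg_stepCount_sq hs]
    field_simp
  refine le_trans ?_ (add_le_add_left (add_le_add_right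
    (mul_le_mul_of_nonneg_left hloss (inv_nonneg.2 hM'.le)) _) _)
  rw [hsq]
  unfold levelFrac
  rw [← levelAvg_ancestor m n, ← levelAvg_const_mul, ← levelAvg_const_mul, ← levelAvg_add,
    ← levelAvg_add]
  refine levelAvg_mono fun i hi => ?_
  have t1 : 0 ≤ (M - 1)⁻¹ * stepLoss s n i :=
    mul_nonneg (inv_nonneg.2 hM'.le) (stepLoss_nonneg s n i)
  have t2 : 0 ≤ ((1 - 2 * c) ^ 2 * (n : ℝ) ^ 2)⁻¹ * (2 * (stepCount s n i : ℝ) - n) ^ 2 := by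
    positivity
  by_cases h : A m (i / 2 ^ n) ≤ (2 : ℝ) ^ (-M)
  swap
  · rw [if_neg h]
    split_ifs <;> linarith
  rw [if_pos h]
  by_cases hW : M - 1 < stepLoss s n i
  · have : 1 ≤ (M - 1)⁻¹ * stepLoss s n i := by
      rw [inv_mul_eq_div, one_le_div hM']
      exact hW.le
    split_ifs <;> linarith
  by_cases hS : (stepCount s n i : ℝ) < c * n
  · have : 1 ≤ ((1 - 2 * c) ^ 2 * (n : ℝ) ^ 2)⁻¹ * (2 * (stepCount s n i : ℝ) - n) ^ 2 := by
      rw [inv_mul_eq_div, one_le_div (by positivity), ← mul_pow, ← neg_sq (2 * _ - _)]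
      exact pow_le_pow_left₀ (by positivity) (by linarith) 2
    split_ifs <;> linarith
  have hfin : A (m + n) i ≤ (2 : ℝ) ^ (-(((2 ^ (m + n) : ℕ) : ℝ) ^ b)) := by
    refine (hA.le_rpow hs m n i hi M h).trans ?_
    refine Real.rpow_le_rpow_of_exponent_le one_le_two (neg_le_neg ?_)
    calc ((2 ^ (m + n) : ℕ) : ℝ) ^ b = (2 : ℝ) ^ (b * ((m + n : ℕ) : ℝ)) := by
          rw [Nat.cast_pow, ← Real.rpow_natCast, ← Real.rpow_mul (by norm_num), mul_comm]
          norm_num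
      _ ≤ (2 : ℝ) ^ (stepCount s n i : ℝ) :=
          Real.rpow_le_rpow_of_exponent_le one_le_two (hbc.trans (not_lt.1 hS))
      _ = (2 : ℝ) ^ stepCount s n i * 1 := by rw [Real.rpow_natCast, mul_one]
      _ ≤ _ := by
          gcongr
          linarith
  rw [if_pos hfin]
  linarith

open Filter in
lemma IsSquaringProcess.eventually_le_levelFrac {A : ℕ → ℕ → ℝ} {s : ℕ}
    (hA : IsSquaringProcess A s) (hs : s = 0 ∨ s = 1) {b a : ℝ} (hb : b < 1 / 2)
    (h : ∀ δ > 0, ∀ ε > 0, ∃ m, a - ε ≤ levelFrac m (fun i => A m i ≤ δ)) {ε : ℝ} (hε : 0 < ε) :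
    ∀ᶠ k in atTop,
      a - ε ≤ levelFrac k (fun i => A k i ≤ (2 : ℝ) ^ (-(((2 ^ k : ℕ) : ℝ) ^ b))) := by
  obtain ⟨c, hbc, hc⟩ := exists_between hb
  obtain ⟨m, hm⟩ := h ((2 : ℝ) ^ (-(1 + 9 / ε))) (by positivity) (ε / 3) (by positivity)
  have e1 : ∀ᶠ n : ℕ in atTop, ((1 - 2 * c) ^ 2 * n)⁻¹ ≤ ε / 3 := by
    have h2 : 0 < (1 - 2 * c) ^ 2 := pow_pos (by linarith) 2
    refine (Tendsto.eventually_le_const (by positivity) (tendsto_inv_atTop_zero.comp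
      (tendsto_natCast_atTop_atTop.const_mul_atTop h2)))
  have e2 : ∀ᶠ n : ℕ in atTop, b * m ≤ (c - b) * n :=
    (tendsto_natCast_atTop_atTop.const_mul_atTop (sub_pos.2 hbc)).eventually_ge_atTop _
  obtain ⟨N, hN⟩ := eventually_atTop.1 (e1.and (e2.and (eventually_gt_atTop 0)))
  filter_upwards [eventually_ge_atTop (m + N)] with k hk
  obtain ⟨n, rfl⟩ := Nat.exists_eq_add_of_le ((Nat.le_add_right m N).trans hk)
  obtain ⟨h1, h2, h3⟩ := hN n (by omega)
  have hle := hA.levelFrac_le hs (b := b) (c := c) (M := 1 + 9 / ε)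
    (by linarith [show 0 < 9 / ε by positivity]) hc m n h3 (by push_cast; linarith)
  have h4 : (1 + 9 / ε - 1)⁻¹ * 3 = ε / 3 := by
    field_simp
    norm_num
  linarith

/-- The functional `∑ b, φ (q (0, b)) (q (1, b))` of a joint pmf with binary first component. -/
def sideSum {γ : Type*} [Fintype γ] (φ : ℝ → ℝ → ℝ) (q : ZMod 2 × γ → ℝ) : ℝ :=
  ∑ b, φ (q (0, b)) (q (1, b))

lemma sum_zmod_two (f : ZMod 2 → ℝ) : ∑ u, f u = f 0 + f 1 := Fin.sum_univ_two f

/-- The joint pmf of `U₁ = X₁ + X₂` and `(Y₁, Y₂)`. -/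
def minusPMF {γ : Type*} (q : ZMod 2 × γ → ℝ) : ZMod 2 × (γ × γ) → ℝ :=
  fun z => ∑ v, q (z.1 + v, z.2.1) * q (v, z.2.2)

/-- The joint pmf of `U₂ = X₂` and `(X₁ + X₂, Y₁, Y₂)`. -/
def plusPMF {γ : Type*} (q : ZMod 2 × γ → ℝ) : ZMod 2 × (ZMod 2 × γ × γ) → ℝ :=
  fun z => q (z.2.1 + z.1, z.2.2.1) * q (z.1, z.2.2.2)

section Functionals

variable {γ : Type*} [Fintype γ] {q : ZMod 2 × γ → ℝ} (φ : ℝ → ℝ → ℝ)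

lemma sideSum_minusPMF : sideSum φ (minusPMF q) = ∑ x, ∑ y,
    φ (q (0, x) * q (0, y) + q (1, x) * q (1, y)) (q (1, x) * q (0, y) + q (0, x) * q (1, y)) := by
  simp only [sideSum, minusPMF, Fintype.sum_prod_type, sum_zmod_two, zero_add, add_zero,
    show (1 : ZMod 2) + 1 = 0 from rfl]

lemma sideSum_plusPMF : sideSum φ (plusPMF q) = ∑ x, ∑ y,
    (φ (q (0, x) * q (0, y)) (q (1, x) * q (1, y)) +
      φ (q (1, x) * q (0, y)) (q (0, x) * q (1, y))) := by
  simp only [sideSum, plusPMF, Fintype.sum_prod_type, sum_zmod_two, zero_add, add_zero,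
    show (1 : ZMod 2) + 1 = 0 from rfl, Finset.sum_add_distrib]

/-- The Bhattacharyya summand. -/
def bhatTerm (a b : ℝ) : ℝ := 2 * √(a * b)

/-- The variational distance summand. -/
def tvTerm (a b : ℝ) : ℝ := |a - b|

/-- The conditional entropy summand. -/
def entTerm (a b : ℝ) : ℝ :=
  -(a * Real.logb 2 (a / (a + b)) + b * Real.logb 2 (b / (a + b)))

lemma bhat_eq_sideSum : bhat q = sideSum bhatTerm q := by
  simp only [bhat, sideSum, bhatTerm, Finset.mul_sum]

lemma condEnt_eq_sideSum : condEnt q = sideSum entTerm q := by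
  simp only [condEnt, margSnd, sideSum, entTerm, sum_zmod_two, Finset.sum_neg_distrib,
    Finset.sum_add_distrib]

lemma IsPMF.sum_add (hq : IsPMF q) : ∑ x, (q (0, x) + q (1, x)) = 1 := by
  rw [← hq.2, Fintype.sum_prod_type, sum_zmod_two, Finset.sum_add_distrib]

/-- Summing a bilinear expression in the marginals of a pmf and of a functional. -/
lemma IsPMF.sum_sum_add_mul (hq : IsPMF q) (f : γ → ℝ) :
    ∑ x, ∑ y, ((q (0, y) + q (1, y)) * f x + (q (0, x) + q (1, x)) * f y) = 2 * ∑ x, f x := by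
  simp only [Finset.sum_add_distrib, ← Finset.sum_mul, ← Finset.mul_sum]
  rw [← Finset.sum_add_distrib, hq.sum_add]
  ring

lemma bhatTerm_nonneg (a b : ℝ) : 0 ≤ bhatTerm a b := by
  unfold bhatTerm
  positivity

lemma bhatTerm_plus {a b c d : ℝ} (ha : 0 ≤ a) (hb : 0 ≤ b) :
    bhatTerm (a * c) (b * d) + bhatTerm (b * c) (a * d) = bhatTerm a b * bhatTerm c d := by
  unfold bhatTerm
  rw [show a * c * (b * d) = a * b * (c * d) by ring,
    show b * c * (a * d) = a * b * (c * d) by ring, Real.sqrt_mul (mul_nonneg ha hb)]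
  ring

lemma bhatTerm_minus {a b c d : ℝ} (ha : 0 ≤ a) (hb : 0 ≤ b) (hc : 0 ≤ c) (hd : 0 ≤ d) :
    bhatTerm (a * c + b * d) (b * c + a * d) ≤
      (c + d) * bhatTerm a b + (a + b) * bhatTerm c d - bhatTerm a b * bhatTerm c d := by
  unfold bhatTerm
  rw [Real.sqrt_mul ha, Real.sqrt_mul hc]
  obtain ⟨α, hα, rfl⟩ : ∃ α, 0 ≤ α ∧ a = α ^ 2 := ⟨√a, Real.sqrt_nonneg _, (Real.sq_sqrt ha).symm⟩
  obtain ⟨β, hβ, rfl⟩ : ∃ α, 0 ≤ α ∧ b = α ^ 2 := ⟨√b, Real.sqrt_nonneg _, (Real.sq_sqrt hb).symm⟩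
  obtain ⟨γ, hγ, rfl⟩ : ∃ α, 0 ≤ α ∧ c = α ^ 2 := ⟨√c, Real.sqrt_nonneg _, (Real.sq_sqrt hc).symm⟩
  obtain ⟨δ, hδ, rfl⟩ : ∃ α, 0 ≤ α ∧ d = α ^ 2 := ⟨√d, Real.sqrt_nonneg _, (Real.sq_sqrt hd).symm⟩
  rw [Real.sqrt_sq hα, Real.sqrt_sq hβ, Real.sqrt_sq hγ, Real.sqrt_sq hδ]
  have h1 : 0 ≤ α * β := mul_nonneg hα hβ
  have h2 : 0 ≤ γ * δ := mul_nonneg hγ hδ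
  have key : √((α ^ 2 * γ ^ 2 + β ^ 2 * δ ^ 2) * (β ^ 2 * γ ^ 2 + α ^ 2 * δ ^ 2)) ≤
      (γ ^ 2 + δ ^ 2) * (α * β) + (α ^ 2 + β ^ 2) * (γ * δ) - 2 * (α * β) * (γ * δ) := by
    refine Real.sqrt_le_iff.2 ⟨?_, ?_⟩
    · nlinarith [mul_nonneg h1 (sq_nonneg (γ - δ)), mul_nonneg h2 (add_nonneg (sq_nonneg α)
        (sq_nonneg β))]
    · have : 0 ≤ 2 * ((α * β) * (γ * δ)) * ((γ - δ) ^ 2 * (α - β) ^ 2) := by positivity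
      nlinarith [this]
  linarith

lemma tvTerm_minus (a b c d : ℝ) :
    tvTerm (a * c + b * d) (b * c + a * d) = tvTerm a b * tvTerm c d := by
  unfold tvTerm
  rw [← abs_mul]
  ring_nf

lemma tvTerm_plus {a b c d : ℝ} (ha : 0 ≤ a) (hb : 0 ≤ b) (hc : 0 ≤ c) (hd : 0 ≤ d) :
    tvTerm (a * c) (b * d) + tvTerm (b * c) (a * d) ≤
      (c + d) * tvTerm a b + (a + b) * tvTerm c d := by
  unfold tvTerm
  have h1 : |a * c - b * d| ≤ ((c + d) * |a - b| + (a + b) * |c - d|) / 2 := by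
    rw [show a * c - b * d = ((c + d) * (a - b) + (a + b) * (c - d)) / 2 by ring, abs_div, abs_two]
    gcongr
    refine (abs_add_le _ _).trans_eq ?_
    rw [abs_mul, abs_mul, abs_of_nonneg (add_nonneg hc hd), abs_of_nonneg (add_nonneg ha hb)]
  have h2 : |b * c - a * d| ≤ ((c + d) * |a - b| + (a + b) * |c - d|) / 2 := by
    rw [show b * c - a * d = ((c + d) * (b - a) + (a + b) * (c - d)) / 2 by ring, abs_div, abs_two]
    gcongr
    refine (abs_add_le _ _).trans_eq ?_
    rw [abs_mul, abs_mul, abs_of_nonneg (add_nonneg hc hd), abs_of_nonneg (add_nonneg ha hb),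
      abs_sub_comm]
  linarith

lemma entTerm_eq {a b : ℝ} (ha : 0 ≤ a) (hb : 0 ≤ b) : entTerm a b =
    (a + b) * Real.logb 2 (a + b) - a * Real.logb 2 a - b * Real.logb 2 b := by
  unfold entTerm
  rcases ha.eq_or_lt with rfl | ha
  · rcases eq_or_ne b 0 with rfl | hb <;> simp [*]
  rcases hb.eq_or_lt with rfl | hb
  · simp [ha.ne']
  rw [Real.logb_div ha.ne' (by positivity), Real.logb_div hb.ne' (by positivity)]
  ring

lemma mul_mul_logb_mul (x y : ℝ) : x * y * Real.logb 2 (x * y) =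
    x * (y * Real.logb 2 y) + y * (x * Real.logb 2 x) := by
  rcases eq_or_ne x 0 with rfl | hx
  · simp
  rcases eq_or_ne y 0 with rfl | hy
  · simp
  rw [Real.logb_mul hx hy]
  ring

lemma entTerm_minus_add_plus {a b c d : ℝ} (ha : 0 ≤ a) (hb : 0 ≤ b) (hc : 0 ≤ c) (hd : 0 ≤ d) :
    entTerm (a * c + b * d) (b * c + a * d) +
      (entTerm (a * c) (b * d) + entTerm (b * c) (a * d)) =
      (c + d) * entTerm a b + (a + b) * entTerm c d := by
  have hsum : a * c + b * d + (b * c + a * d) = (a + b) * (c + d) := by ring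
  rw [entTerm_eq (by positivity) (by positivity), entTerm_eq (by positivity) (by positivity),
    entTerm_eq (by positivity) (by positivity), entTerm_eq ha hb, entTerm_eq hc hd, hsum]
  simp only [mul_mul_logb_mul]
  ring

lemma entTerm_nonneg {a b : ℝ} (ha : 0 ≤ a) (hb : 0 ≤ b) : 0 ≤ entTerm a b := by
  have h : ∀ x y : ℝ, 0 ≤ x → 0 ≤ y → x * Real.logb 2 (x / (x + y)) ≤ 0 := fun x y hx hy =>
    mul_nonpos_of_nonneg_of_nonpos hx (Real.logb_nonpos one_lt_two (by positivity)
      (div_le_one_of_le₀ (by linarith) (by positivity)))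
  have h1 := h a b ha hb
  have h2 := h b a hb ha
  rw [add_comm b a] at h2
  unfold entTerm
  linarith

/-- The tangent line bound `-x log (x / s) ≤ x log 2 + s / 2 - x`. -/
lemma neg_mul_log_div_le {x s : ℝ} (hx : 0 ≤ x) (hxs : x ≤ s) :
    -(x * Real.log (x / s)) ≤ x * Real.log 2 + (s / 2 - x) := by
  rcases hx.eq_or_lt with rfl | hx
  · simp only [zero_mul, neg_zero]
    linarith
  have hs : 0 < s := hx.trans_le hxs
  have h := Real.log_le_sub_one_of_pos (show 0 < s / (2 * x) by positivity)
  rw [Real.log_div hs.ne' (by positivity), Real.log_mul two_ne_zero hx.ne'] at h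
  rw [Real.log_div hx.ne' hs.ne']
  have h' := mul_le_mul_of_nonneg_left h hx.le
  have : x * (s / (2 * x) - 1) = s / 2 - x := by field_simp
  linarith

/-- The tangent line bound `x log 2 + x (1 - 2 x / s) ≤ -x log (x / s)`. -/
lemma le_neg_mul_log_div {x s : ℝ} (hx : 0 ≤ x) (hxs : x ≤ s) :
    x * Real.log 2 + x * (1 - 2 * x / s) ≤ -(x * Real.log (x / s)) := by
  rcases hx.eq_or_lt with rfl | hx
  · simp
  have hs : 0 < s := hx.trans_le hxs
  have h := Real.log_le_sub_one_of_pos (show 0 < 2 * x / s by positivity)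
  rw [Real.log_div (by positivity) hs.ne', Real.log_mul two_ne_zero hx.ne'] at h
  rw [Real.log_div hx.ne' hs.ne']
  have h' := mul_le_mul_of_nonneg_left h hx.le
  linarith

/-- The bound `-x log (x / s) ≤ 2 (√(x s) - x)`. -/
lemma neg_mul_log_div_le_sqrt {x s : ℝ} (hx : 0 ≤ x) (hxs : x ≤ s) :
    -(x * Real.log (x / s)) ≤ 2 * (√x * √s - x) := by
  rcases hx.eq_or_lt with rfl | hx
  · simp
  have hs : 0 < s := hx.trans_le hxs
  have hx' := Real.sqrt_pos.2 hx
  have hs' := Real.sqrt_pos.2 hs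
  have h := Real.log_le_sub_one_of_pos (show 0 < √s / √x by positivity)
  rw [Real.log_div hs'.ne' hx'.ne', Real.log_sqrt hx.le, Real.log_sqrt hs.le] at h
  rw [Real.log_div hx.ne' hs.ne']
  have h' := mul_le_mul_of_nonneg_left h hx.le
  have : x * (√s / √x - 1) = √x * √s - x := by
    field_simp
    nlinarith [Real.mul_self_sqrt hx.le]
  linarith

lemma entTerm_mul_log_two (a b : ℝ) : entTerm a b * Real.log 2 =
    -(a * Real.log (a / (a + b))) + -(b * Real.log (b / (a + b))) := by
  have : Real.log 2 ≠ 0 := (Real.log_pos one_lt_two).ne'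
  simp only [entTerm, Real.logb]
  field_simp
  ring

lemma half_le_log_two : 1 / 2 ≤ Real.log 2 := by
  linarith [Real.log_two_gt_d9]

lemma entTerm_le_add {a b : ℝ} (ha : 0 ≤ a) (hb : 0 ≤ b) : entTerm a b ≤ a + b := by
  refine le_of_mul_le_mul_right ?_ (Real.log_pos one_lt_two)
  rw [entTerm_mul_log_two]
  linarith [neg_mul_log_div_le ha (show a ≤ a + b by linarith),
    neg_mul_log_div_le hb (show b ≤ a + b by linarith)]

lemma add_sub_le_entTerm {a b : ℝ} (ha : 0 ≤ a) (hb : 0 ≤ b) :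
    a + b - 2 * tvTerm a b ≤ entTerm a b := by
  refine le_of_mul_le_mul_right ?_ (Real.log_pos one_lt_two)
  rw [entTerm_mul_log_two]
  have h1 := le_neg_mul_log_div ha (show a ≤ a + b by linarith)
  have h2 := le_neg_mul_log_div hb (show b ≤ a + b by linarith)
  have h3 : -|a - b| ≤ a * (1 - 2 * a / (a + b)) + b * (1 - 2 * b / (a + b)) := by
    rcases (add_nonneg ha hb).eq_or_lt with h0 | h0
    · obtain rfl : a = 0 := by linarith
      obtain rfl : b = 0 := by linarith
      simp
    · have h4 : a * (1 - 2 * a / (a + b)) + b * (1 - 2 * b / (a + b)) =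
          -(|a - b| * (|a - b| / (a + b))) := by
        rw [← mul_div_assoc, abs_mul_abs_self]
        field_simp
        ring
      have h5 : |a - b| / (a + b) ≤ 1 :=
        div_le_one_of_le₀ (abs_le.2 ⟨by linarith, by linarith⟩) h0.le
      rw [h4]
      nlinarith [abs_nonneg (a - b)]
  unfold tvTerm
  nlinarith [abs_nonneg (a - b), half_le_log_two]

lemma entTerm_le_bhatTerm {a b : ℝ} (ha : 0 ≤ a) (hb : 0 ≤ b) :
    entTerm a b ≤ 2 * bhatTerm a b := by
  refine le_of_mul_le_mul_right ?_ (Real.log_pos one_lt_two)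
  rw [entTerm_mul_log_two]
  have h1 := neg_mul_log_div_le_sqrt ha (show a ≤ a + b by linarith)
  have h2 := neg_mul_log_div_le_sqrt hb (show b ≤ a + b by linarith)
  unfold bhatTerm
  rw [Real.sqrt_mul ha]
  have hab := mul_nonneg (Real.sqrt_nonneg a) (Real.sqrt_nonneg b)
  have h3 : √(a + b) * (√a + √b) ≤ √a * √b + (a + b) := by
    rw [← Real.sqrt_sq (add_nonneg (Real.sqrt_nonneg a) (Real.sqrt_nonneg b)),
      ← Real.sqrt_mul (by positivity)]
    refine Real.sqrt_le_iff.2 ⟨by positivity, ?_⟩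
    have e1 := Real.sq_sqrt ha
    have e2 := Real.sq_sqrt hb
    nlinarith [sq_nonneg (√a * √b)]
  nlinarith [half_le_log_two]

/-- The variational distance between the two conditional branches of a joint pmf. -/
def tv (q : ZMod 2 × γ → ℝ) : ℝ := sideSum tvTerm q

lemma tv_nonneg : 0 ≤ tv q := Finset.sum_nonneg fun _ _ => abs_nonneg _

lemma bhat_nonneg : 0 ≤ bhat q := by
  rw [bhat_eq_sideSum]
  exact Finset.sum_nonneg fun _ _ => bhatTerm_nonneg _ _

lemma tv_minusPMF : tv (minusPMF q) = tv q ^ 2 := by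
  rw [tv, tv, sideSum_minusPMF, sq, sideSum, Finset.sum_mul_sum]
  exact Finset.sum_congr rfl fun x _ => Finset.sum_congr rfl fun y _ => tvTerm_minus _ _ _ _

namespace IsPMF

variable (hq : IsPMF q)
include hq

lemma bhat_plusPMF : bhat (plusPMF q) = bhat q ^ 2 := by
  rw [bhat_eq_sideSum, bhat_eq_sideSum, sideSum_plusPMF, sq, sideSum, Finset.sum_mul_sum]
  exact Finset.sum_congr rfl fun x _ => Finset.sum_congr rfl fun y _ =>
    bhatTerm_plus (hq.1 _) (hq.1 _)

lemma bhat_minusPMF_le : bhat (minusPMF q) ≤ 2 * bhat q - bhat q ^ 2 := by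
  rw [bhat_eq_sideSum, bhat_eq_sideSum, sideSum_minusPMF, sq, sideSum, Finset.sum_mul_sum,
    ← hq.sum_sum_add_mul, ← Finset.sum_sub_distrib]
  refine Finset.sum_le_sum fun x _ => ?_
  rw [← Finset.sum_sub_distrib]
  exact Finset.sum_le_sum fun y _ => bhatTerm_minus (hq.1 _) (hq.1 _) (hq.1 _) (hq.1 _)

lemma tv_plusPMF_le : tv (plusPMF q) ≤ 2 * tv q := by
  rw [tv, tv, sideSum_plusPMF, sideSum, ← hq.sum_sum_add_mul]
  exact Finset.sum_le_sum fun x _ => Finset.sum_le_sum fun y _ =>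
    tvTerm_plus (hq.1 _) (hq.1 _) (hq.1 _) (hq.1 _)

lemma condEnt_minusPMF_add_plusPMF :
    condEnt (minusPMF q) + condEnt (plusPMF q) = 2 * condEnt q := by
  rw [condEnt_eq_sideSum, condEnt_eq_sideSum, condEnt_eq_sideSum, sideSum_minusPMF,
    sideSum_plusPMF, sideSum, ← hq.sum_sum_add_mul, ← Finset.sum_add_distrib]
  refine Finset.sum_congr rfl fun x _ => ?_
  rw [← Finset.sum_add_distrib]
  exact Finset.sum_congr rfl fun y _ =>
    entTerm_minus_add_plus (hq.1 _) (hq.1 _) (hq.1 _) (hq.1 _)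

lemma condEnt_nonneg : 0 ≤ condEnt q := by
  rw [condEnt_eq_sideSum]
  exact Finset.sum_nonneg fun _ _ => entTerm_nonneg (hq.1 _) (hq.1 _)

lemma condEnt_le_one : condEnt q ≤ 1 := by
  rw [condEnt_eq_sideSum, ← hq.sum_add]
  exact Finset.sum_le_sum fun _ _ => entTerm_le_add (hq.1 _) (hq.1 _)

lemma condEnt_le_bhat : condEnt q ≤ 2 * bhat q := by
  rw [condEnt_eq_sideSum, bhat_eq_sideSum, sideSum, sideSum, Finset.mul_sum]
  exact Finset.sum_le_sum fun _ _ => entTerm_le_bhatTerm (hq.1 _) (hq.1 _)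

lemma one_sub_condEnt_le_tv : 1 - condEnt q ≤ 2 * tv q := by
  rw [condEnt_eq_sideSum, ← hq.sum_add, sub_le_comm, tv, sideSum, sideSum, Finset.mul_sum,
    ← Finset.sum_sub_distrib]
  exact Finset.sum_le_sum fun _ _ => add_sub_le_entTerm (hq.1 _) (hq.1 _)

lemma one_sub_bhat_le_tv : 1 - bhat q ≤ tv q := by
  rw [bhat_eq_sideSum, ← hq.sum_add, sub_le_comm, tv, sideSum, sideSum,
    ← Finset.sum_sub_distrib]
  refine Finset.sum_le_sum fun x _ => ?_
  unfold tvTerm bhatTerm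
  have ha := hq.1 (0, x)
  have hb := hq.1 (1, x)
  rcases le_total (q (0, x)) (q (1, x)) with h | h
  · rw [abs_of_nonpos (sub_nonpos.2 h)]
    have := Real.le_sqrt_of_sq_le (show q (0, x) ^ 2 ≤ q (0, x) * q (1, x) by nlinarith)
    linarith
  · rw [abs_of_nonneg (sub_nonneg.2 h)]
    have := Real.le_sqrt_of_sq_le (show q (1, x) ^ 2 ≤ q (0, x) * q (1, x) by nlinarith)
    linarith

lemma tv_sq_add_bhat_sq_le : tv q ^ 2 + bhat q ^ 2 ≤ 1 := by
  have ha := fun x => hq.1 (0, x)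
  have hb := fun x => hq.1 (1, x)
  have h := Finset.sum_mul_sq_le_sq_mul_sq Finset.univ
    (fun x => |√(q (0, x)) - √(q (1, x))|) (fun x => √(q (0, x)) + √(q (1, x)))
  have h1 : ∑ x, |√(q (0, x)) - √(q (1, x))| * (√(q (0, x)) + √(q (1, x))) = tv q := by
    refine Finset.sum_congr rfl fun x _ => ?_
    rw [tvTerm, ← abs_of_nonneg (show 0 ≤ √(q (0, x)) + √(q (1, x)) by positivity), ← abs_mul]
    congr 1
    linear_combination Real.sq_sqrt (ha x) - Real.sq_sqrt (hb x)
  have h2 : ∑ x, |√(q (0, x)) - √(q (1, x))| ^ 2 = 1 - bhat q := by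
    rw [← hq.sum_add, bhat_eq_sideSum, sideSum, ← Finset.sum_sub_distrib]
    refine Finset.sum_congr rfl fun x _ => ?_
    rw [sq_abs, bhatTerm, Real.sqrt_mul (ha x)]
    linear_combination Real.sq_sqrt (ha x) + Real.sq_sqrt (hb x)
  have h3 : ∑ x, (√(q (0, x)) + √(q (1, x))) ^ 2 = 1 + bhat q := by
    rw [← hq.sum_add, bhat_eq_sideSum, sideSum, ← Finset.sum_add_distrib]
    refine Finset.sum_congr rfl fun x _ => ?_
    rw [bhatTerm, Real.sqrt_mul (ha x)]
    linear_combination Real.sq_sqrt (ha x) + Real.sq_sqrt (hb x)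
  rw [h1, h2, h3] at h
  linarith

lemma bhat_le_one : bhat q ≤ 1 := by
  nlinarith [hq.tv_sq_add_bhat_sq_le, sq_nonneg (tv q)]

end IsPMF

end Functionals

section Pushforward

variable {Ω Ω' γ γ' : Type*} [Fintype Ω] [Fintype Ω']

lemma IsPMF.pushPMF [Fintype γ] [DecidableEq γ] {P : Ω → ℝ} (hP : IsPMF P) (f : Ω → γ) :
    IsPMF (pushPMF P f) := by
  refine ⟨fun b => Finset.sum_nonneg fun a _ => ?_, ?_⟩
  · split_ifs
    exacts [hP.1 a, le_rfl]
  · simp only [_root_.pushPMF]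
    rw [Finset.sum_comm]
    simpa using hP.2

lemma pushPMF_comp_equiv [DecidableEq γ] (P : Ω → ℝ) (f : Ω → γ) (e : Ω' ≃ Ω) :
    pushPMF (fun ω => P (e ω)) (fun ω => f (e ω)) = pushPMF P f := by
  funext b
  exact Equiv.sum_comp e (M := ℝ) fun a => if f a = b then P a else 0

lemma sideSum_pushPMF_injective [Fintype γ] [Fintype γ'] [DecidableEq γ] [DecidableEq γ']
    {φ : ℝ → ℝ → ℝ} (hφ : φ 0 0 = 0) (P : Ω → ℝ) (A : Ω → ZMod 2) (B : Ω → γ) {f : γ → γ'}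
    (hf : Function.Injective f) :
    sideSum φ (pushPMF P (fun ω => (A ω, f (B ω)))) =
      sideSum φ (pushPMF P (fun ω => (A ω, B ω))) := by
  refine (Fintype.sum_of_injective f hf _ _ (fun c hc => ?_) fun c => ?_).symm
  · have h : ∀ u, pushPMF P (fun ω => (A ω, f (B ω))) (u, c) = 0 := fun u =>
      Finset.sum_eq_zero fun ω _ => if_neg fun h => hc ⟨B ω, congrArg Prod.snd h⟩
    rw [h, h, hφ]
  · simp only [pushPMF, Prod.mk.injEq, hf.eq_iff]

lemma pushPMF_minus [DecidableEq γ] (P : Ω → ℝ) (V : Ω → ZMod 2) (B : Ω → γ) :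
    pushPMF (fun w : Ω × Ω => P w.1 * P w.2) (fun w => (V w.1 + V w.2, (B w.1, B w.2))) =
      minusPMF (pushPMF P (fun ω => (V ω, B ω))) := by
  funext ⟨u, b₁, b₂⟩
  simp only [pushPMF, minusPMF, Fintype.sum_prod_type, Finset.sum_mul_sum, Prod.mk.injEq]
  symm
  refine Finset.sum_comm.trans (Finset.sum_congr rfl fun w₁ _ => ?_)
  rw [Finset.sum_comm]
  refine Finset.sum_congr rfl fun w₂ _ => ?_
  rw [Finset.sum_eq_single (V w₂)]
  · have : V w₁ + V w₂ = u ↔ V w₁ = u + V w₂ := by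
      generalize V w₁ = a
      generalize V w₂ = b
      revert a b u
      decide
    simp only [this]
    split_ifs <;> simp_all
  · intro v _ hv
    rw [if_neg (c := V w₂ = v ∧ _) fun h => hv h.1.symm, mul_zero]
  · simp

lemma pushPMF_plus [DecidableEq γ] (P : Ω → ℝ) (V : Ω → ZMod 2) (B : Ω → γ) :
    pushPMF (fun w : Ω × Ω => P w.1 * P w.2)
        (fun w => (V w.2, (V w.1 + V w.2, (B w.1, B w.2)))) =
      plusPMF (pushPMF P (fun ω => (V ω, B ω))) := by
  funext ⟨u, v, b₁, b₂⟩
  simp only [pushPMF, plusPMF, Fintype.sum_prod_type, Finset.sum_mul_sum, Prod.mk.injEq]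
  refine Finset.sum_congr rfl fun w₁ _ => Finset.sum_congr rfl fun w₂ _ => ?_
  have : V w₂ = u → (V w₁ + V w₂ = v ↔ V w₁ = v + u) := by
    generalize V w₁ = a
    generalize V w₂ = b
    revert a b u v
    decide
  split_ifs <;> simp_all

end Pushforward

section Recursion

variable {β : Type*}

/-- The index splitting used in the Kronecker recursion defining `polarG`. -/
def polarIdx (k : ℕ) : Fin (2 ^ k) × Fin 2 ≃ Fin (2 ^ (k + 1)) :=
  finProdFinEquiv.trans (finCongr (pow_succ 2 k).symm)

lemma polarIdx_val (k : ℕ) (i : Fin (2 ^ k)) (c : Fin 2) :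
    (polarIdx k (i, c)).val = c.val + 2 * i.val := rfl

/-- Interleaving of two words of length `2 ^ k`. -/
def interleave {α : Type*} (k : ℕ) (a b : Fin (2 ^ k) → α) (l : Fin (2 ^ (k + 1))) : α :=
  if ((polarIdx k).symm l).2 = 0 then a ((polarIdx k).symm l).1 else b ((polarIdx k).symm l).1

@[simp]
lemma interleave_zero {α : Type*} (k : ℕ) (a b : Fin (2 ^ k) → α) (i : Fin (2 ^ k)) :
    interleave k a b (polarIdx k (i, 0)) = a i := by
  simp [interleave]

@[simp]
lemma interleave_one {α : Type*} (k : ℕ) (a b : Fin (2 ^ k) → α) (i : Fin (2 ^ k)) :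
    interleave k a b (polarIdx k (i, 1)) = b i := by
  simp [interleave]

/-- Pairs of words of length `2 ^ k` are words of length `2 ^ (k + 1)`. -/
def interleaveEquiv (α : Type*) (k : ℕ) :
    (Fin (2 ^ k) → α) × (Fin (2 ^ k) → α) ≃ (Fin (2 ^ (k + 1)) → α) where
  toFun w := interleave k w.1 w.2
  invFun x := (fun i => x (polarIdx k (i, 0)), fun i => x (polarIdx k (i, 1)))
  left_inv w := by simp
  right_inv x := by
    funext l
    obtain ⟨⟨i, c⟩, rfl⟩ := (polarIdx k).surjective l
    fin_cases c <;> simp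

/-- The two half-length blocks of a block of `2 ^ (k + 1)` copies of `(X, Y)`. -/
def blockEquiv (β : Type*) (k : ℕ) :
    ((Fin (2 ^ k) → ZMod 2) × (Fin (2 ^ k) → β)) × ((Fin (2 ^ k) → ZMod 2) × (Fin (2 ^ k) → β)) ≃
      (Fin (2 ^ (k + 1)) → ZMod 2) × (Fin (2 ^ (k + 1)) → β) :=
  (Equiv.prodProdProdComm _ _ _ _).trans ((interleaveEquiv _ k).prodCongr (interleaveEquiv _ k))

lemma iidPair_blockEquiv [Fintype β] (p : ZMod 2 × β → ℝ) (k : ℕ)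
    (w : ((Fin (2 ^ k) → ZMod 2) × (Fin (2 ^ k) → β)) ×
      ((Fin (2 ^ k) → ZMod 2) × (Fin (2 ^ k) → β))) :
    iidPair p (2 ^ (k + 1)) (blockEquiv β k w) =
      iidPair p (2 ^ k) w.1 * iidPair p (2 ^ k) w.2 := by
  unfold iidPair
  rw [← (polarIdx k).prod_comp, Fintype.prod_prod_type, ← Finset.prod_mul_distrib]
  refine Finset.prod_congr rfl fun i _ => ?_
  rw [Fin.prod_univ_two]
  simp [blockEquiv, interleaveEquiv]

lemma polarU_succ (k : ℕ) (x : Fin (2 ^ (k + 1)) → ZMod 2) (i : Fin (2 ^ k)) (c : Fin 2) :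
    polarU (k + 1) x (polarIdx k (i, c)) = ∑ j, (x (polarIdx k (j, 0)) * (polarG k j i *
      (!![1, 0; 1, 1] : Matrix (Fin 2) (Fin 2) (ZMod 2)) 0 c) + x (polarIdx k (j, 1)) *
      (polarG k j i * (!![1, 0; 1, 1] : Matrix (Fin 2) (Fin 2) (ZMod 2)) 1 c)) := by
  unfold polarU Matrix.vecMul dotProduct
  rw [← (polarIdx k).sum_comp, Fintype.sum_prod_type]
  refine Finset.sum_congr rfl fun j _ => ?_
  have h : ∀ z w, polarG (k + 1) (polarIdx k z) (polarIdx k w) = polarG k z.1 w.1 *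
      (!![1, 0; 1, 1] : Matrix (Fin 2) (Fin 2) (ZMod 2)) z.2 w.2 := by
    intro z w
    change Matrix.reindex (polarIdx k) (polarIdx k) _ _ _ = _
    simp
  rw [Fin.sum_univ_two]
  exact congrArg₂ (· + ·) (congrArg (x _ * ·) (h (j, 0) (i, c)))
    (congrArg (x _ * ·) (h (j, 1) (i, c)))

lemma polarU_interleave_zero (k : ℕ) (x₁ x₂ : Fin (2 ^ k) → ZMod 2) (i : Fin (2 ^ k)) :
    polarU (k + 1) (interleave k x₁ x₂) (polarIdx k (i, 0)) = polarU k x₁ i + polarU k x₂ i := by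
  rw [polarU_succ]
  simp [polarU, Matrix.vecMul, dotProduct, Finset.sum_add_distrib]

lemma polarU_interleave_one (k : ℕ) (x₁ x₂ : Fin (2 ^ k) → ZMod 2) (i : Fin (2 ^ k)) :
    polarU (k + 1) (interleave k x₁ x₂) (polarIdx k (i, 1)) = polarU k x₂ i := by
  rw [polarU_succ]
  simp [polarU, Matrix.vecMul, dotProduct]

/-- The first `2 * i` polarized symbols of a block from the first `i` ones of its halves. -/
def joinPast (i : ℕ) (v : (Fin i → ZMod 2) × (Fin i → ZMod 2)) (j : Fin (2 * i)) : ZMod 2 :=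
  if j.val % 2 = 0 then v.1 ⟨j.val / 2, by omega⟩ + v.2 ⟨j.val / 2, by omega⟩
  else v.2 ⟨j.val / 2, by omega⟩

lemma joinPast_injective (i : ℕ) : Function.Injective (joinPast i) := by
  rintro ⟨v₁, v₂⟩ ⟨w₁, w₂⟩ h
  have h₂ : v₂ = w₂ := by
    funext j
    have := congrFun h ⟨2 * j.val + 1, by omega⟩
    simpa [joinPast, two_mul_add_one_div_two] using this
  subst h₂
  have h₁ : v₁ = w₁ := by
    funext j
    have := congrFun h ⟨2 * j.val, by omega⟩
    simpa [joinPast] using this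
  rw [h₁]

lemma polarU_interleave_past (k : ℕ) (x₁ x₂ : Fin (2 ^ k) → ZMod 2) (i : ℕ) (hi : i ≤ 2 ^ k)
    (hi' : 2 * i ≤ 2 ^ (k + 1)) :
    (fun j : Fin (2 * i) => polarU (k + 1) (interleave k x₁ x₂) (Fin.castLE hi' j)) =
      joinPast i (fun j => polarU k x₁ (Fin.castLE hi j), fun j => polarU k x₂ (Fin.castLE hi j)) := by
  funext j
  have hj : j.val / 2 < 2 ^ k := by omega
  unfold joinPast
  split_ifs with h
  · rw [show Fin.castLE hi' j = polarIdx k (⟨j.val / 2, hj⟩, 0) from Fin.ext (by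
      rw [polarIdx_val, Fin.val_castLE, Fin.val_zero]; dsimp only; omega), polarU_interleave_zero]
    rfl
  · rw [show Fin.castLE hi' j = polarIdx k (⟨j.val / 2, hj⟩, 1) from Fin.ext (by
      rw [polarIdx_val, Fin.val_castLE, Fin.val_one]; dsimp only; omega), polarU_interleave_one]
    rfl

variable [Fintype β] [DecidableEq β] (p : ZMod 2 × β → ℝ)

/-- The joint pmf of `U^i` and `(Y^{1:n}, U^{1:i-1})`. -/
def polarJoint (k : ℕ) (i : Fin (2 ^ k)) :
    ZMod 2 × ((Fin (2 ^ k) → β) × (Fin i.val → ZMod 2)) → ℝ :=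
  pushPMF (iidPair p (2 ^ k))
    (fun xy => (polarU k xy.1 i,
      (xy.2, fun j : Fin i.val => polarU k xy.1 (Fin.castLE i.isLt.le j))))

variable {p}

omit [DecidableEq β] in
lemma IsPMF.isPMF_iidPair (hp : IsPMF p) (n : ℕ) : IsPMF (iidPair p n) := by
  refine ⟨fun xy => Finset.prod_nonneg fun i _ => hp.1 _, ?_⟩
  rw [← (Equiv.arrowProdEquivProdArrow (Fin n) (fun _ => ZMod 2) (fun _ => β)).sum_comp]
  have h := Finset.prod_univ_sum (fun _ : Fin n => (Finset.univ : Finset (ZMod 2 × β)))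
    (fun _ z => p z)
  rw [Fintype.piFinset_univ] at h
  simp only [hp.2, Finset.prod_const_one] at h
  exact h.symm

lemma IsPMF.isPMF_polarJoint (hp : IsPMF p) (k : ℕ) (i : Fin (2 ^ k)) : IsPMF (polarJoint p k i) :=
  (hp.isPMF_iidPair _).pushPMF _

variable {φ : ℝ → ℝ → ℝ} (hφ : φ 0 0 = 0)
include hφ

lemma sideSum_polarJoint_zero (i : Fin (2 ^ 0)) : sideSum φ (polarJoint p 0 i) = sideSum φ p := by
  obtain rfl : i = 0 := Subsingleton.elim (α := Fin 1) _ _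
  let e : ZMod 2 × β ≃ (Fin (2 ^ 0) → ZMod 2) × (Fin (2 ^ 0) → β) :=
    (Equiv.funUnique (Fin 1) (ZMod 2)).symm.prodCongr (Equiv.funUnique (Fin 1) β).symm
  have hinj : Function.Injective (fun y : β =>
      ((fun _ => y, fun _ => 0) : (Fin (2 ^ 0) → β) × (Fin 0 → ZMod 2))) := fun y z h =>
    congrFun (congrArg Prod.fst h) 0
  have h := sideSum_pushPMF_injective hφ p (fun z => z.1) (fun z => z.2) hinj
  have hid : pushPMF p (fun z => (z.1, z.2)) = p := by
    funext z
    simp [pushPMF]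
  rw [hid] at h
  rw [← h, polarJoint, ← pushPMF_comp_equiv _ _ e]
  congr 2
  · funext z
    exact Fin.prod_univ_one _
  · funext z
    refine Prod.ext ?_ (Prod.ext rfl (Subsingleton.elim (α := Fin 0 → ZMod 2) _ _))
    simp [polarU, polarG, e]

lemma sideSum_polarJoint_even (k : ℕ) (i : Fin (2 ^ k)) (h : 2 * i.val < 2 ^ (k + 1)) :
    sideSum φ (polarJoint p (k + 1) ⟨2 * i.val, h⟩) =
      sideSum φ (minusPMF (polarJoint p k i)) := by
  have hinj : Function.Injective
      (fun z : ((Fin (2 ^ k) → β) × (Fin i.val → ZMod 2)) ×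
          ((Fin (2 ^ k) → β) × (Fin i.val → ZMod 2)) =>
        (interleaveEquiv β k (z.1.1, z.2.1), joinPast i.val (z.1.2, z.2.2))) := by
    rintro ⟨⟨y₁, v₁⟩, ⟨y₂, v₂⟩⟩ ⟨⟨y₁', v₁'⟩, ⟨y₂', v₂'⟩⟩ h
    have h₁ := (interleaveEquiv β k).injective (congrArg Prod.fst h)
    have h₂ := joinPast_injective i.val (congrArg Prod.snd h)
    simp_all
  rw [polarJoint, polarJoint, ← pushPMF_comp_equiv _ _ (blockEquiv β k), ← pushPMF_minus,
    ← sideSum_pushPMF_injective hφ _ _ _ hinj]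
  congr 2
  · funext w
    exact iidPair_blockEquiv p k w
  · funext w
    refine Prod.ext ?_ (Prod.ext rfl ?_)
    · refine (congrArg (polarU (k + 1) (interleave k w.1.1 w.2.1)) (Fin.ext ?_)).trans
        (polarU_interleave_zero k w.1.1 w.2.1 i)
      rw [polarIdx_val, Fin.val_zero, zero_add]
    · exact polarU_interleave_past k _ _ i.val i.isLt.le h.le

lemma sideSum_polarJoint_odd (k : ℕ) (i : Fin (2 ^ k)) (h : 2 * i.val + 1 < 2 ^ (k + 1)) :
    sideSum φ (polarJoint p (k + 1) ⟨2 * i.val + 1, h⟩) =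
      sideSum φ (plusPMF (polarJoint p k i)) := by
  have hinj : Function.Injective
      (fun z : ZMod 2 × ((Fin (2 ^ k) → β) × (Fin i.val → ZMod 2)) ×
          ((Fin (2 ^ k) → β) × (Fin i.val → ZMod 2)) =>
        (interleaveEquiv β k (z.2.1.1, z.2.2.1),
          (Fin.snoc (joinPast i.val (z.2.1.2, z.2.2.2)) z.1 : Fin (2 * i.val + 1) → ZMod 2))) := by
    rintro ⟨u, ⟨y₁, v₁⟩, ⟨y₂, v₂⟩⟩ ⟨u', ⟨y₁', v₁'⟩, ⟨y₂', v₂'⟩⟩ h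
    have h₁ := (interleaveEquiv β k).injective (congrArg Prod.fst h)
    obtain ⟨h₂, h₃⟩ := Fin.snoc_injective2 (α := fun _ => ZMod 2) (congrArg Prod.snd h)
    have h₄ := joinPast_injective i.val h₂
    simp_all
  rw [polarJoint, polarJoint, ← pushPMF_comp_equiv _ _ (blockEquiv β k), ← pushPMF_plus,
    ← sideSum_pushPMF_injective hφ _ _ _ hinj]
  congr 2
  · funext w
    exact iidPair_blockEquiv p k w
  · funext w
    refine Prod.ext ?_ (Prod.ext rfl ?_)
    · refine (congrArg (polarU (k + 1) (interleave k w.1.1 w.2.1)) (Fin.ext ?_)).trans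
        (polarU_interleave_one k w.1.1 w.2.1 i)
      rw [polarIdx_val, Fin.val_one]
      exact add_comm _ _
    · dsimp only
      rw [← polarU_interleave_past k _ _ i.val i.isLt.le (Nat.le_of_succ_le h.le)]
      funext j
      refine Fin.lastCases ?_ (fun j => ?_) j
      · rw [Fin.snoc_last, ← polarU_interleave_zero]
        congr 1
        exact Fin.ext (by rw [polarIdx_val, Fin.val_zero, zero_add]; rfl)
      · rw [Fin.snoc_castSucc]
        rfl

end Recursion

section Polarization

variable {β : Type*} [Fintype β] [DecidableEq β]

/-- The functional with summand `φ` of the joint pmf of `U^i` and `(Y^{1:n}, U^{1:i-1})`, for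
indices counted from zero; it is zero out of range. -/
def polarVal (φ : ℝ → ℝ → ℝ) (p : ZMod 2 × β → ℝ) (k i : ℕ) : ℝ :=
  if h : i < 2 ^ k then sideSum φ (polarJoint p k ⟨i, h⟩) else 0

variable {p : ZMod 2 × β → ℝ}

lemma polarVal_eq (φ : ℝ → ℝ → ℝ) (k : ℕ) {i : ℕ} (h : i < 2 ^ k) :
    polarVal φ p k i = sideSum φ (polarJoint p k ⟨i, h⟩) := dif_pos h

lemma polarVal_even {φ : ℝ → ℝ → ℝ} (hφ : φ 0 0 = 0) (k : ℕ) {i : ℕ} (h : i < 2 ^ k) :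
    polarVal φ p (k + 1) (2 * i) = sideSum φ (minusPMF (polarJoint p k ⟨i, h⟩)) := by
  rw [polarVal_eq φ (k + 1) (by rw [pow_succ]; omega)]
  exact sideSum_polarJoint_even hφ k ⟨i, h⟩ _

lemma polarVal_odd {φ : ℝ → ℝ → ℝ} (hφ : φ 0 0 = 0) (k : ℕ) {i : ℕ} (h : i < 2 ^ k) :
    polarVal φ p (k + 1) (2 * i + 1) = sideSum φ (plusPMF (polarJoint p k ⟨i, h⟩)) := by
  rw [polarVal_eq φ (k + 1) (by rw [pow_succ]; omega)]
  exact sideSum_polarJoint_odd hφ k ⟨i, h⟩ _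

lemma bhatTerm_zero : bhatTerm 0 0 = 0 := by simp [bhatTerm]

lemma tvTerm_zero : tvTerm 0 0 = 0 := by simp [tvTerm]

lemma entTerm_zero : entTerm 0 0 = 0 := by simp [entTerm]

lemma polarZ_eq_polarVal (k : ℕ) (i : Fin (2 ^ k)) : polarZ p k i = polarVal bhatTerm p k i := by
  rw [polarVal_eq bhatTerm k i.isLt, ← bhat_eq_sideSum]
  rfl

variable (hp : IsPMF p)
include hp

lemma IsPMF.isSquaringProcess_bhat : IsSquaringProcess (polarVal bhatTerm p) 1 where
  nonneg k i h := by
    rw [polarVal_eq _ k h, ← bhat_eq_sideSum]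
    exact bhat_nonneg
  le_sq k i h := by
    rw [polarVal_odd bhatTerm_zero k h, polarVal_eq _ k h, ← bhat_eq_sideSum, ← bhat_eq_sideSum]
    exact (hp.isPMF_polarJoint k _).bhat_plusPMF.le
  le_two_mul k i h := by
    rw [tsub_self, add_zero, polarVal_even bhatTerm_zero k h, polarVal_eq _ k h,
      ← bhat_eq_sideSum, ← bhat_eq_sideSum]
    exact (hp.isPMF_polarJoint k _).bhat_minusPMF_le.trans (sub_le_self _ (sq_nonneg _))

lemma IsPMF.isSquaringProcess_tv : IsSquaringProcess (polarVal tvTerm p) 0 where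
  nonneg k i h := by
    rw [polarVal_eq _ k h]
    exact tv_nonneg
  le_sq k i h := by
    rw [add_zero, polarVal_even tvTerm_zero k h, polarVal_eq _ k h]
    exact tv_minusPMF.le
  le_two_mul k i h := by
    rw [tsub_zero, polarVal_odd tvTerm_zero k h, polarVal_eq _ k h]
    exact (hp.isPMF_polarJoint k _).tv_plusPMF_le

lemma IsPMF.levelAvg_condEnt (k : ℕ) : levelAvg k (polarVal entTerm p k) = condEnt p := by
  induction k with
  | zero =>
    simp only [levelAvg, pow_zero, Finset.range_one, Finset.sum_singleton, div_one]
    rw [polarVal_eq _ 0 (by norm_num), sideSum_polarJoint_zero entTerm_zero, condEnt_eq_sideSum]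
  | succ k ih =>
    rw [levelAvg_succ, ← ih]
    refine levelAvg_congr fun i h => ?_
    have := (hp.isPMF_polarJoint k ⟨i, h⟩).condEnt_minusPMF_add_plusPMF
    rw [polarVal_even entTerm_zero k h, polarVal_odd entTerm_zero k h, polarVal_eq _ k h,
      ← condEnt_eq_sideSum, ← condEnt_eq_sideSum, ← condEnt_eq_sideSum]
    linarith

lemma IsPMF.levelAvg_one_sub_bhat_sq_succ (k : ℕ) :
    levelAvg k (fun i => (1 - polarVal bhatTerm p k i) ^ 2) +
        levelAvg k (fun i => (polarVal bhatTerm p k i * (1 - polarVal bhatTerm p k i)) ^ 2) ≤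
      levelAvg (k + 1) (fun i => (1 - polarVal bhatTerm p (k + 1) i) ^ 2) := by
  rw [levelAvg_succ, ← levelAvg_add]
  refine levelAvg_mono fun i h => ?_
  rw [polarVal_even bhatTerm_zero k h, polarVal_odd bhatTerm_zero k h, polarVal_eq _ k h,
    ← bhat_eq_sideSum, ← bhat_eq_sideSum, ← bhat_eq_sideSum]
  have h1 := (hp.isPMF_polarJoint k ⟨i, h⟩).bhat_plusPMF
  have h2 := (hp.isPMF_polarJoint k ⟨i, h⟩).bhat_minusPMF_le
  rw [h1]
  generalize bhat (polarJoint p k ⟨i, h⟩) = z at *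
  have h3 : ((1 - z) ^ 2) ^ 2 ≤ (1 - bhat (minusPMF (polarJoint p k ⟨i, h⟩))) ^ 2 :=
    pow_le_pow_left₀ (sq_nonneg _) (by linarith) 2
  linarith

open Filter in
lemma IsPMF.tendsto_levelAvg_bhat_mul_one_sub :
    Tendsto (fun k => levelAvg k
      (fun i => (polarVal bhatTerm p k i * (1 - polarVal bhatTerm p k i)) ^ 2)) atTop (nhds 0) := by
  set Q : ℕ → ℝ := fun k => levelAvg k (fun i => (1 - polarVal bhatTerm p k i) ^ 2) with hQ
  have hnn : ∀ k, 0 ≤ levelAvg k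
      (fun i => (polarVal bhatTerm p k i * (1 - polarVal bhatTerm p k i)) ^ 2) := fun k => by
    rw [← levelAvg_const k 0]
    exact levelAvg_mono fun i _ => sq_nonneg _
  have hmono : Monotone Q := monotone_nat_of_le_succ fun k =>
    (le_add_of_nonneg_right (hnn k)).trans (hp.levelAvg_one_sub_bhat_sq_succ k)
  have hbdd : BddAbove (Set.range Q) := by
    refine ⟨1, ?_⟩
    rintro _ ⟨k, rfl⟩
    refine (levelAvg_mono fun i h => ?_).trans (levelAvg_const k 1).le
    rw [polarVal_eq _ k h, ← bhat_eq_sideSum]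
    have h1 := (hp.isPMF_polarJoint k ⟨i, h⟩).bhat_le_one
    have h0 := bhat_nonneg (q := polarJoint p k ⟨i, h⟩)
    nlinarith
  have hlim := tendsto_atTop_ciSup hmono hbdd
  have hdiff := ((tendsto_add_atTop_iff_nat 1).2 hlim).sub hlim
  rw [sub_self] at hdiff
  refine squeeze_zero hnn (fun k => ?_) hdiff
  have := hp.levelAvg_one_sub_bhat_sq_succ k
  simp only [hQ]
  linarith

/-- If a quantity of average `a` is at most one, and is small outside the set `P` unless the
Bhattacharyya parameter is bounded away from zero and one, then `P` has limiting proportion at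
least `a`. -/
lemma IsPMF.exists_le_levelFrac {F : ℕ → ℕ → ℝ} {P : ℕ → ℕ → Prop} {a ε δ : ℝ} (hε : 0 < ε)
    (hδ : 0 < δ) (hF : ∀ k, levelAvg k (F k) = a) (hF1 : ∀ k, ∀ i < 2 ^ k, F k i ≤ 1)
    (hsmall : ∀ k, ∀ i < 2 ^ k, polarVal bhatTerm p k i ≤ δ ∨ 1 - δ ≤ polarVal bhatTerm p k i →
      P k i ∨ F k i ≤ ε / 2) :
    ∃ m, a - ε ≤ levelFrac m (P m) := by
  have hD := (hp.tendsto_levelAvg_bhat_mul_one_sub.const_mul ((δ ^ 2) ^ 2)⁻¹).eventually_le_const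
    (show ((δ ^ 2) ^ 2)⁻¹ * 0 < ε / 2 by rw [mul_zero]; positivity)
  obtain ⟨m, hm⟩ := hD.exists
  refine ⟨m, ?_⟩
  have hle : a ≤ levelFrac m (P m) + ((δ ^ 2) ^ 2)⁻¹ * levelAvg m
      (fun i => (polarVal bhatTerm p m i * (1 - polarVal bhatTerm p m i)) ^ 2) + ε / 2 := by
    rw [← hF m, levelFrac, ← levelAvg_const_mul, ← levelAvg_const m (ε / 2), ← levelAvg_add,
      ← levelAvg_add]
    refine levelAvg_mono fun i h => ?_
    have hs := hsmall m i h
    have h1 := hF1 m i h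
    generalize polarVal bhatTerm p m i = z at *
    have hd : 0 ≤ ((δ ^ 2) ^ 2)⁻¹ * (z * (1 - z)) ^ 2 := by positivity
    by_cases hP : P m i
    · rw [if_pos hP]
      linarith
    rw [if_neg hP]
    by_cases hz : z ≤ δ ∨ 1 - δ ≤ z
    · have := (hs hz).resolve_left hP
      linarith
    push Not at hz
    have : 1 ≤ ((δ ^ 2) ^ 2)⁻¹ * (z * (1 - z)) ^ 2 := by
      rw [inv_mul_eq_div, one_le_div (by positivity)]
      refine pow_le_pow_left₀ (by positivity) ?_ 2
      nlinarith
    linarith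
  linarith

lemma IsPMF.exists_le_levelFrac_bhat {δ ε : ℝ} (hδ : 0 < δ) (hε : 0 < ε) :
    ∃ m, 1 - condEnt p - ε ≤ levelFrac m (fun i => polarVal bhatTerm p m i ≤ δ) := by
  refine hp.exists_le_levelFrac (F := fun k i => 1 - polarVal entTerm p k i)
    (P := fun k i => polarVal bhatTerm p k i ≤ δ) (δ := min δ (ε ^ 2 / 32)) hε (by positivity)
    (fun k => ?_) (fun k i h => ?_) (fun k i h hz => ?_)
  · have := levelAvg_add k (fun i => 1 - polarVal entTerm p k i) (polarVal entTerm p k)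
    simp only [sub_add_cancel, levelAvg_const, hp.levelAvg_condEnt] at this
    linarith
  · rw [polarVal_eq _ k h, ← condEnt_eq_sideSum]
    linarith [(hp.isPMF_polarJoint k ⟨i, h⟩).condEnt_nonneg]
  · refine hz.imp (fun h => h.trans (min_le_left _ _)) fun hz => ?_
    rw [polarVal_eq _ k h, ← bhat_eq_sideSum] at hz
    rw [polarVal_eq _ k h, ← condEnt_eq_sideSum]
    have h1 := (hp.isPMF_polarJoint k ⟨i, h⟩).one_sub_condEnt_le_tv
    have h2 := (hp.isPMF_polarJoint k ⟨i, h⟩).tv_sq_add_bhat_sq_le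
    have h3 := min_le_right δ (ε ^ 2 / 32)
    have h4 : tv (polarJoint p k ⟨i, h⟩) ≤ ε / 4 := by
      refine (pow_le_pow_iff_left₀ tv_nonneg (by positivity) two_ne_zero).1 ?_
      nlinarith [sq_nonneg (1 - bhat (polarJoint p k ⟨i, h⟩))]
    linarith

lemma IsPMF.exists_le_levelFrac_tv {δ ε : ℝ} (hδ : 0 < δ) (hε : 0 < ε) :
    ∃ m, condEnt p - ε ≤ levelFrac m (fun i => polarVal tvTerm p m i ≤ δ) := by
  refine hp.exists_le_levelFrac (F := fun k i => polarVal entTerm p k i)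
    (P := fun k i => polarVal tvTerm p k i ≤ δ) (δ := min (ε / 4) (δ ^ 2 / 2)) hε (by positivity)
    hp.levelAvg_condEnt (fun k i h => ?_) (fun k i h hz => ?_)
  · rw [polarVal_eq _ k h, ← condEnt_eq_sideSum]
    exact (hp.isPMF_polarJoint k ⟨i, h⟩).condEnt_le_one
  · rw [polarVal_eq _ k h, ← bhat_eq_sideSum] at hz
    rw [polarVal_eq _ k h, polarVal_eq _ k h, ← condEnt_eq_sideSum]
    refine hz.symm.imp (fun hz => ?_) fun hz => ?_
    · have h2 := (hp.isPMF_polarJoint k ⟨i, h⟩).tv_sq_add_bhat_sq_le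
      have h3 := min_le_right (ε / 4) (δ ^ 2 / 2)
      refine (pow_le_pow_iff_left₀ tv_nonneg hδ.le two_ne_zero).1 ?_
      nlinarith [sq_nonneg (1 - bhat (polarJoint p k ⟨i, h⟩))]
    · have h1 := (hp.isPMF_polarJoint k ⟨i, h⟩).condEnt_le_bhat
      have h3 := min_le_left (ε / 4) (δ ^ 2 / 2)
      linarith

end Polarization

open Filter in
lemma tendsto_of_eventually_sub_le_of_add_le_one {f g : ℕ → ℝ} {a : ℝ}
    (hf : ∀ ε > 0, ∀ᶠ k in atTop, a - ε ≤ f k) (hg : ∀ ε > 0, ∀ᶠ k in atTop, 1 - a - ε ≤ g k)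
    (hfg : ∀ᶠ k in atTop, f k + g k ≤ 1) : Tendsto f atTop (nhds a) := by
  refine tendsto_order.2 ⟨fun c hc => ?_, fun c hc => ?_⟩
  · filter_upwards [hf ((a - c) / 2) (by linarith)] with k hk
    linarith
  · filter_upwards [hg ((c - a) / 2) (by linarith), hfg] with k hk hk'
    linarith

/-- polarization. For β ∈ (0,1/2), the fraction of indices with
`Z(U^i|Y^{1:n},U^{1:i-1}) ≥ 1 - 2^{-n^β}` tends to `H(X|Y)`, and the fraction with
`Z(U^i|Y^{1:n},U^{1:i-1}) ≤ 2^{-n^β}` tends to `1 - H(X|Y)`, as k → ∞ (n = 2^k). -/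
theorem polarization {β : Type*} [Fintype β] [DecidableEq β]
    (p : ZMod 2 × β → ℝ) (hp : IsPMF p)
    (b : ℝ) (hb0 : 0 < b) (hb : b < 1 / 2) :
    Filter.Tendsto (fun k : ℕ =>
        (Nat.card {i : Fin (2 ^ k) //
            1 - Real.rpow 2 (-(Real.rpow ((2 ^ k : ℕ) : ℝ) b)) ≤ polarZ p k i} : ℝ)
          / ((2 ^ k : ℕ) : ℝ))
      Filter.atTop (nhds (condEnt p)) ∧
    Filter.Tendsto (fun k : ℕ =>
        (Nat.card {i : Fin (2 ^ k) //
            polarZ p k i ≤ Real.rpow 2 (-(Real.rpow ((2 ^ k : ℕ) : ℝ) b))} : ℝ)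
          / ((2 ^ k : ℕ) : ℝ))
      Filter.atTop (nhds (1 - condEnt p)) := by
  have hZ : ∀ ε > 0, ∀ᶠ k in Filter.atTop, 1 - condEnt p - ε ≤ levelFrac k
      (fun i => polarVal bhatTerm p k i ≤ (2 : ℝ) ^ (-(((2 ^ k : ℕ) : ℝ) ^ b))) := fun ε hε =>
    hp.isSquaringProcess_bhat.eventually_le_levelFrac (Or.inr rfl) hb
      (fun δ hδ ε hε => hp.exists_le_levelFrac_bhat hδ hε) hε
  have hT : ∀ ε > 0, ∀ᶠ k in Filter.atTop, condEnt p - ε ≤ levelFrac k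
      (fun i => 1 - (2 : ℝ) ^ (-(((2 ^ k : ℕ) : ℝ) ^ b)) ≤ polarVal bhatTerm p k i) := fun ε hε => by
    filter_upwards [hp.isSquaringProcess_tv.eventually_le_levelFrac (Or.inl rfl) hb
      (fun δ hδ ε hε => hp.exists_le_levelFrac_tv hδ hε) hε] with k hk
    refine hk.trans (levelFrac_mono fun i h hi => ?_)
    rw [polarVal_eq _ k h] at hi
    rw [polarVal_eq _ k h, ← bhat_eq_sideSum]
    have h1 : 1 - bhat _ ≤ sideSum _ _ := (hp.isPMF_polarJoint k ⟨i, h⟩).one_sub_bhat_le_tv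
    linarith
  have hdisj : ∀ᶠ k in Filter.atTop, levelFrac k
      (fun i => 1 - (2 : ℝ) ^ (-(((2 ^ k : ℕ) : ℝ) ^ b)) ≤ polarVal bhatTerm p k i) + levelFrac k
      (fun i => polarVal bhatTerm p k i ≤ (2 : ℝ) ^ (-(((2 ^ k : ℕ) : ℝ) ^ b))) ≤ 1 := by
    filter_upwards [Filter.eventually_gt_atTop 0] with k hk
    refine levelFrac_add_le_one fun i _ h1 h2 => ?_
    have h3 : (1 : ℝ) < ((2 ^ k : ℕ) : ℝ) ^ b :=
      Real.one_lt_rpow (by exact_mod_cast Nat.one_lt_two_pow hk.ne') hb0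
    have h4 := Real.rpow_lt_rpow_of_exponent_lt one_lt_two (neg_lt_neg h3)
    rw [Real.rpow_neg_one] at h4
    linarith
  refine ⟨?_, ?_⟩
  · refine (tendsto_of_eventually_sub_le_of_add_le_one hT hZ hdisj).congr fun k => ?_
    exact (natCard_div_eq_levelFrac k _ _ fun i => by rw [polarZ_eq_polarVal]; rfl).symm
  · refine (tendsto_of_eventually_sub_le_of_add_le_one hZ
      (fun ε hε => (hT ε hε).mono fun k hk => by rwa [sub_sub_cancel])
      (hdisj.mono fun k hk => by rwa [add_comm])).congr fun k => ?_
    exact (natCard_div_eq_levelFrac k _ _ fun i => by rw [polarZ_eq_polarVal]; rfl).symm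
end
end
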